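/- arXiv:1911.07647 — 3 statements merged into one kernel-verified Lean document; each statement's English description precedes it below -/
import Mathlib

section
/- Let N ≥ 1 and let y_0,…,y_{N−1} ∈ [−1,1]. Run the first-order greedy ΣΔ quantizer on (y_n) to obtain state variables (u_n) and bits (q_n). Set δ := −u_{N−1}/N and define updated samples ỹ_n := y_n + δ for 0 ≤ n ≤ N−1. Run the first-order greedy ΣΔ quantizer on (ỹ_n) to obtain state variables (ũ_n). Then ũ_{N−1} = 0. -/
noncomputable section

/-- sign(x) = 1 if x > 0, -1 if x ≤ 0. -/
def sgn (x : ℝ) : ℝ := if 0 < x then 1 else -1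

/-- One step of the greedy quantizer enlarges the interval `(-1 - a, 1 + b]` containing the state
by at most the amount by which the sample can leave `[-1, 1]`. -/
lemma greedy_step_bounds {v y a b c d : ℝ} (ha : 0 ≤ a + c) (hb : 0 ≤ b + d)
    (hv : -1 - a < v ∧ v ≤ 1 + b) (hy : -1 - c ≤ y ∧ y ≤ 1 + d) :
    -1 - (a + c) < v + y - sgn (v + y) ∧ v + y - sgn (v + y) ≤ 1 + (b + d) := by
  unfold sgn
  split_ifs <;> constructor <;> linarith [hv.1, hv.2, hy.1, hy.2]

/-- Any two values of `sgn` differ by an even integer. -/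
lemma exists_sgn_sub_sgn_eq_two_mul (x z : ℝ) : ∃ k : ℤ, sgn x - sgn z = 2 * k := by
  unfold sgn
  split_ifs
  exacts [⟨0, by norm_num⟩, ⟨1, by norm_num⟩, ⟨-1, by norm_num⟩, ⟨0, by norm_num⟩]

/-- If the samples lie within `[-1 - c, 1 + d]`, the greedy state after `m` steps lies in
`(-1 - m c, 1 + m d]`. -/
lemma greedy_state_bounds {N : ℤ} {y u : ℤ → ℝ} {c d : ℝ} (hc : 0 ≤ c) (hd : 0 ≤ d)
    (hy : ∀ n : ℤ, 0 ≤ n → n < N → -1 - c ≤ y n ∧ y n ≤ 1 + d)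
    (hu_init : u (-1) = 0)
    (hu : ∀ n : ℤ, 0 ≤ n → n < N → u n = u (n - 1) + y n - sgn (u (n - 1) + y n))
    (m : ℕ) (hm : (m : ℤ) ≤ N) :
    -1 - m * c < u (m - 1) ∧ u (m - 1) ≤ 1 + m * d := by
  induction m with
  | zero => simp [hu_init]
  | succ m ih =>
    push_cast at hm ⊢
    have h := greedy_step_bounds (by positivity) (by positivity) (ih (by lia))
      (hy m (by lia) (by lia))
    rw [add_sub_cancel_right, hu m (by lia) (by lia), add_one_mul, add_one_mul]
    exact h

/-- Shifting every sample by `δ` changes the greedy state after `m` steps by `m δ` modulo `2`. -/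
lemma greedy_state_shift {N : ℤ} {y u w : ℤ → ℝ} {δ : ℝ}
    (hu_init : u (-1) = 0) (hw_init : w (-1) = 0)
    (hu : ∀ n : ℤ, 0 ≤ n → n < N → u n = u (n - 1) + y n - sgn (u (n - 1) + y n))
    (hw : ∀ n : ℤ, 0 ≤ n → n < N →
      w n = w (n - 1) + (y n + δ) - sgn (w (n - 1) + (y n + δ)))
    (m : ℕ) (hm : (m : ℤ) ≤ N) :
    ∃ k : ℤ, w (m - 1) = u (m - 1) + m * δ + 2 * k := by
  induction m with
  | zero => exact ⟨0, by simp [hu_init, hw_init]⟩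
  | succ m ih =>
    push_cast at hm ⊢
    obtain ⟨k, hk⟩ := ih (by lia)
    obtain ⟨l, hl⟩ := exists_sgn_sub_sgn_eq_two_mul (u (m - 1) + y m) (w (m - 1) + (y m + δ))
    refine ⟨k + l, ?_⟩
    rw [add_sub_cancel_right, hu m (by lia) (by lia), hw m (by lia) (by lia)]
    push_cast
    linarith

/-- **Uniform update for the first-order greedy ΣΔ quantizer.**
Running the first-order greedy ΣΔ quantizer on samples `y₀,…,y_{N-1} ∈ [-1,1]`
gives state variables `u` and bits `q`.  Setting `δ = -u_{N-1}/N` and re-running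
the quantizer on the updated samples `ỹₙ = yₙ + δ` gives state variables `ũ`
with `ũ_{N-1} = 0`. -/
theorem first_order_update (N : ℤ) (hN : 1 ≤ N)
    (y u q uu qq : ℤ → ℝ)
    (hy : ∀ n : ℤ, 0 ≤ n → n < N → y n ∈ Set.Icc (-1 : ℝ) 1)
    (hu_init : u (-1) = 0)
    (hq : ∀ n : ℤ, 0 ≤ n → n < N → q n = sgn (u (n - 1) + y n))
    (hu : ∀ n : ℤ, 0 ≤ n → n < N → u n = u (n - 1) + y n - q n)
    (δ : ℝ) (hδ : δ = -(u (N - 1)) / N)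
    (huu_init : uu (-1) = 0)
    (hqq : ∀ n : ℤ, 0 ≤ n → n < N → qq n = sgn (uu (n - 1) + (y n + δ)))
    (huu : ∀ n : ℤ, 0 ≤ n → n < N → uu n = uu (n - 1) + (y n + δ) - qq n) :
    uu (N - 1) = 0 := by
  have hu' : ∀ n : ℤ, 0 ≤ n → n < N → u n = u (n - 1) + y n - sgn (u (n - 1) + y n) :=
    fun n h0 hn => by rw [hu n h0 hn, hq n h0 hn]
  have huu' : ∀ n : ℤ, 0 ≤ n → n < N →
      uu n = uu (n - 1) + (y n + δ) - sgn (uu (n - 1) + (y n + δ)) :=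
    fun n h0 hn => by rw [huu n h0 hn, hqq n h0 hn]
  lift N to ℕ using by lia
  have hN0 : (0 : ℝ) < N := by exact_mod_cast hN
  have hNδ : N * δ = -u (N - 1) := by
    rw [hδ]
    push_cast
    field_simp
  obtain ⟨k, hk⟩ := greedy_state_shift hu_init huu_init hu' huu' N le_rfl
  have hb := greedy_state_bounds le_rfl le_rfl
    (fun n h0 hn => by simpa using hy n h0 hn) hu_init hu' N le_rfl
  have hbb := greedy_state_bounds (y := fun n => y n + δ) (le_max_right (-δ) 0)
    (le_max_right δ 0)
    (fun n h0 hn => ⟨by linarith [(hy n h0 hn).1, le_max_left (-δ) 0],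
      by linarith [(hy n h0 hn).2, le_max_left δ 0]⟩) huu_init huu' N le_rfl
  rw [mul_max_of_nonneg _ _ hN0.le, mul_max_of_nonneg _ _ hN0.le, mul_neg, hNδ, neg_neg,
    mul_zero] at hbb
  rw [mul_zero, sub_zero, add_zero] at hb
  have hlo : max (u (N - 1)) 0 ≤ 1 := max_le hb.2 zero_le_one
  have hhi : max (-u (N - 1)) 0 < 1 := max_lt (by linarith [hb.1]) one_pos
  have huk : uu (N - 1) = 2 * k := by linarith
  have hk1 : (-1 : ℝ) < k := by linarith [hbb.1]
  have hk2 : (k : ℝ) < 1 := by linarith [hbb.2]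
  have hk0 : k = 0 := by
    have h1 : -1 < k := by exact_mod_cast hk1
    have h2 : k < 1 := by exact_mod_cast hk2
    lia
  rw [huk, hk0, Int.cast_zero, mul_zero]
end
end

section
/- Let k ≥ 2 and let h = (h_0, h_1, …, h_k) be the second-order feedback filter with h_0 = 0, h_1 = k/(k−1), h_j = 0 for 2 ≤ j ≤ k−1, and h_k = 1 − k/(k−1). Let g : ℤ → ℝ be the finitely supported sequence with (Δ²g)_n = δ⁰_n − h_n for all n (δ⁰ the Kronecker delta at 0). Let N ≥ 1 and y_0,…,y_{N−1} ∈ ℝ. Run the ΣΔ quantizer with filter h on (y_n) to obtain (v_n), (q_n), and set u_n := (g∗v)_n = Σ_j g_j v_{n−j}. Set δ := −(Δu)_{N−1}/N and ỹ_n := y_n + δ. Assume the stability criterion ‖h‖_{ℓ¹} ≤ 2 − max_n |ỹ_n| holds. Run the ΣΔ quantizer with filter h on (ỹ_n) to obtain (ṽ_n), (q̃_n), and set ũ_n := (g∗ṽ)_n. Then (Δũ)_{N−1} = ũ_{N−1} − ũ_{N−2} = 0. -/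
noncomputable section

/-- Backward difference of a sequence. -/
def bdiff (u : ℤ → ℝ) : ℤ → ℝ := fun n => u n - u (n - 1)

theorem sgn_eq_or (x : ℝ) : sgn x = 1 ∨ sgn x = -1 := by
  unfold sgn
  split_ifs <;> simp

theorem bdiff_support_finite {a : ℤ → ℝ} (ha : (Function.support a).Finite) :
    (Function.support (bdiff a)).Finite := by
  have hshift : (Function.support fun j => a (j - 1)).Finite :=
    ha.preimage (f := fun j : ℤ => j - 1) (fun x _ y _ hxy => by simpa using hxy)
  exact (ha.union hshift).subset (Function.support_sub a _)

/-- The backward difference of a convolution falls on the first factor. -/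
theorem bdiff_conv {a w c : ℤ → ℝ} (ha : (Function.support a).Finite)
    (hc : ∀ n, c n = ∑ᶠ j : ℤ, a j * w (n - j)) (n : ℤ) :
    bdiff c n = ∑ᶠ j : ℤ, bdiff a j * w (n - j) := by
  have hshift : ∑ᶠ j : ℤ, a j * w (n - 1 - j) = ∑ᶠ j : ℤ, a (j - 1) * w (n - j) := by
    rw [← finsum_comp_equiv (Equiv.subRight (1 : ℤ))]
    refine finsum_congr fun j => ?_
    simp only [Equiv.subRight_apply]
    congr 2
    ring
  have h1 : (Function.support fun j => a j * w (n - j)).Finite :=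
    ha.subset (Function.support_mul_subset_left _ _)
  have h2 : (Function.support fun j => a (j - 1) * w (n - j)).Finite :=
    (ha.preimage (f := fun j : ℤ => j - 1) (fun x _ y _ hxy => by simpa using hxy)).subset
      (Function.support_mul_subset_left (fun j => a (j - 1)) _)
  rw [bdiff, hc, hc, hshift, ← finsum_sub_distrib h1 h2]
  refine finsum_congr fun j => ?_
  simp only [bdiff]
  ring

/-- A finitely supported sequence whose difference vanishes at negative indices vanishes there. -/
theorem eq_zero_of_bdiff_eq_zero {a : ℤ → ℝ} (ha : (Function.support a).Finite)
    (hd : ∀ n < 0, bdiff a n = 0) (n : ℤ) (hn : n < 0) : a n = 0 := by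
  obtain ⟨b, hb⟩ := ha.bddBelow
  have hconst : ∀ t : ℕ, a (n - t) = a n := by
    intro t
    induction t with
    | zero => simp
    | succ t ih =>
      have := hd (n - t) (by omega)
      simp only [bdiff] at this
      rw [← ih]
      push_cast
      rw [← sub_sub]
      linarith
  rw [← hconst (n - b + 1).toNat]
  by_contra hne
  have := hb hne
  omega

theorem filter_conv_eq {k : ℕ} (hk : 2 ≤ k) {h : ℤ → ℝ}
    (hh : ∀ j : ℤ, h j =
      if j = 1 then (k : ℝ) / ((k : ℝ) - 1)
      else if j = (k : ℤ) then 1 - (k : ℝ) / ((k : ℝ) - 1) else 0) (w : ℤ → ℝ) (n : ℤ) :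
    ∑ j ∈ Finset.Icc (1 : ℤ) (k : ℤ), h j * w (n - j) =
      (k : ℝ) / ((k : ℝ) - 1) * w (n - 1) + (1 - (k : ℝ) / ((k : ℝ) - 1)) * w (n - k) := by
  rw [Finset.sum_eq_add (1 : ℤ) (k : ℤ) (by omega)]
  · rw [hh, hh, if_pos rfl, if_neg (by omega), if_pos rfl]
  · intro c _ hc
    rw [hh, if_neg hc.1, if_neg hc.2, zero_mul]
  · intro hc
    exact absurd (Finset.mem_Icc.2 ⟨le_rfl, by omega⟩) hc
  · intro hc
    exact absurd (Finset.mem_Icc.2 ⟨by omega, le_rfl⟩) hc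

theorem filter_norm_eq {k : ℕ} (hk : 2 ≤ k) {h : ℤ → ℝ}
    (hh : ∀ j : ℤ, h j =
      if j = 1 then (k : ℝ) / ((k : ℝ) - 1)
      else if j = (k : ℤ) then 1 - (k : ℝ) / ((k : ℝ) - 1) else 0) :
    ∑ j ∈ Finset.Icc (0 : ℤ) (k : ℤ), |h j| =
      (k : ℝ) / ((k : ℝ) - 1) + ((k : ℝ) / ((k : ℝ) - 1) - 1) := by
  have hk' : (2 : ℝ) ≤ k := by exact_mod_cast hk
  have h1 : 1 ≤ (k : ℝ) / ((k : ℝ) - 1) := by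
    rw [le_div_iff₀ (by linarith)]
    linarith
  rw [Finset.sum_eq_add (1 : ℤ) (k : ℤ) (by omega)]
  · rw [hh, hh, if_pos rfl, if_neg (by omega), if_pos rfl, abs_of_nonneg (by linarith),
      abs_of_nonpos (by linarith)]
    ring
  · intro c _ hc
    rw [hh, if_neg hc.1, if_neg hc.2, abs_zero]
  · intro hc
    exact absurd (Finset.mem_Icc.2 ⟨by omega, by omega⟩) hc
  · intro hc
    exact absurd (Finset.mem_Icc.2 ⟨by omega, le_rfl⟩) hc

theorem bdiff_filter_neg {k : ℕ} {h g : ℤ → ℝ}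
    (hh : ∀ j : ℤ, h j =
      if j = 1 then (k : ℝ) / ((k : ℝ) - 1)
      else if j = (k : ℤ) then 1 - (k : ℝ) / ((k : ℝ) - 1) else 0)
    (hgfin : (Function.support g).Finite)
    (hg : ∀ n : ℤ, bdiff (bdiff g) n = (if n = 0 then (1 : ℝ) else 0) - h n)
    (n : ℤ) (hn : n < 0) : bdiff g n = 0 := by
  refine eq_zero_of_bdiff_eq_zero (bdiff_support_finite hgfin) (fun m hm => ?_) n hn
  rw [hg, hh, if_neg (by omega), if_neg (by omega), if_neg (by omega), sub_zero]

theorem bdiff_filter_nat {k : ℕ} (hk : 2 ≤ k) {h g : ℤ → ℝ}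
    (hh : ∀ j : ℤ, h j =
      if j = 1 then (k : ℝ) / ((k : ℝ) - 1)
      else if j = (k : ℤ) then 1 - (k : ℝ) / ((k : ℝ) - 1) else 0)
    (hgfin : (Function.support g).Finite)
    (hg : ∀ n : ℤ, bdiff (bdiff g) n = (if n = 0 then (1 : ℝ) else 0) - h n) (m : ℕ) :
    bdiff g m = if m = 0 then 1 else if m < k then 1 - (k : ℝ) / ((k : ℝ) - 1) else 0 := by
  induction m with
  | zero =>
    have h0 := hg 0
    rw [hh, if_pos rfl, if_neg (by omega), if_neg (by omega), bdiff,
      bdiff_filter_neg hh hgfin hg (0 - 1) (by omega)] at h0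
    simpa using h0
  | succ m ih =>
    have hs := hg (m + 1 : ℕ)
    rw [hh, if_neg (by omega), bdiff] at hs
    have hm : ((m + 1 : ℕ) : ℤ) - 1 = m := by push_cast; ring
    rw [hm, ih] at hs
    rw [if_neg (by omega)]
    split_ifs at hs ⊢ <;> first | omega | linarith

/-- The first difference of the state telescopes to the accumulated quantization error. -/
theorem bdiff_state_eq_sum {k : ℕ} (hk : 2 ≤ k) {h g : ℤ → ℝ}
    (hh : ∀ j : ℤ, h j =
      if j = 1 then (k : ℝ) / ((k : ℝ) - 1)
      else if j = (k : ℤ) then 1 - (k : ℝ) / ((k : ℝ) - 1) else 0)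
    (hgfin : (Function.support g).Finite)
    (hg : ∀ n : ℤ, bdiff (bdiff g) n = (if n = 0 then (1 : ℝ) else 0) - h n)
    {N : ℕ} {y v q u : ℤ → ℝ}
    (hv0 : ∀ n : ℤ, n < 0 → v n = 0)
    (hv : ∀ n : ℤ, 0 ≤ n → n < (N : ℤ) →
      v n = (∑ j ∈ Finset.Icc (1 : ℤ) (k : ℤ), h j * v (n - j)) + y n - q n)
    (hu : ∀ n : ℤ, u n = ∑ᶠ j : ℤ, g j * v (n - j)) (m : ℕ) (hm : m ≤ N) :
    bdiff u ((m : ℤ) - 1) = ∑ i ∈ Finset.range m, (y i - q i) := by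
  have hconv := bdiff_conv hgfin hu
  have hconv2 := bdiff_conv (bdiff_support_finite hgfin) hconv
  induction m with
  | zero =>
    rw [hconv, Finset.range_zero, Finset.sum_empty]
    refine finsum_eq_zero_of_forall_eq_zero fun j => ?_
    rcases lt_or_ge j 0 with hj | hj
    · rw [bdiff_filter_neg hh hgfin hg j hj, zero_mul]
    · rw [hv0 _ (by push_cast; omega), mul_zero]
  | succ m ih =>
    rw [Finset.sum_range_succ, ← ih (by omega)]
    have hstep : bdiff (bdiff u) m = v m - ∑ j ∈ Finset.Icc (1 : ℤ) (k : ℤ), h j * v (m - j) := by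
      have hsub : (Function.support fun j => bdiff (bdiff g) j * v (m - j)) ⊆
          ↑(Finset.Icc (0 : ℤ) k) := by
        intro j hj
        by_contra hjm
        rw [Finset.mem_coe, Finset.mem_Icc] at hjm
        apply hj
        simp only
        rw [hg, hh, if_neg (by omega), if_neg (by omega), if_neg (by omega), sub_zero, zero_mul]
      have hins : Finset.Icc (0 : ℤ) k = insert 0 (Finset.Icc (1 : ℤ) k) := by
        ext j
        simp only [Finset.mem_Icc, Finset.mem_insert]
        omega
      rw [hconv2, finsum_eq_sum_of_support_subset _ hsub, hins, Finset.sum_insert (by simp),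
        sub_eq_add_neg (v m), ← Finset.sum_neg_distrib]
      congr 1
      · rw [hg, hh, if_pos rfl, if_neg (by omega), if_neg (by omega)]
        simp
      · refine Finset.sum_congr rfl fun j hj => ?_
        rw [Finset.mem_Icc] at hj
        rw [hg, if_neg (by omega)]
        ring
    have hvm := hv m (by omega) (by omega)
    have hidx : ((m + 1 : ℕ) : ℤ) - 1 = m := by push_cast; ring
    rw [hidx]
    rw [bdiff] at hstep
    linarith

/-- Under the stability criterion the quantizer state stays in `(-1, 1]`. -/
theorem state_mem_Ioc {k : ℕ} (hk : 2 ≤ k) {h : ℤ → ℝ}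
    (hh : ∀ j : ℤ, h j =
      if j = 1 then (k : ℝ) / ((k : ℝ) - 1)
      else if j = (k : ℤ) then 1 - (k : ℝ) / ((k : ℝ) - 1) else 0)
    {N : ℕ} {y v q : ℤ → ℝ}
    (hstab : ∑ j ∈ Finset.Icc (0 : ℤ) (k : ℤ), |h j| ≤ 2 - ⨆ n : Fin N, |y ((n : ℕ) : ℤ)|)
    (hv0 : ∀ n : ℤ, n < 0 → v n = 0)
    (hq : ∀ n : ℤ, 0 ≤ n → n < (N : ℤ) →
      q n = sgn ((∑ j ∈ Finset.Icc (1 : ℤ) (k : ℤ), h j * v (n - j)) + y n))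
    (hv : ∀ n : ℤ, 0 ≤ n → n < (N : ℤ) →
      v n = (∑ j ∈ Finset.Icc (1 : ℤ) (k : ℤ), h j * v (n - j)) + y n - q n)
    (n : ℤ) (hn : n < N) : v n ∈ Set.Ioc (-1) 1 := by
  have hk' : (2 : ℝ) ≤ k := by exact_mod_cast hk
  have hα : 1 < (k : ℝ) / ((k : ℝ) - 1) := by
    rw [lt_div_iff₀ (by linarith)]
    linarith
  rw [filter_norm_eq hk hh] at hstab
  have hnat : ∀ m : ℕ, m < N → v m ∈ Set.Ioc (-1) 1 := by
    intro m
    induction m using Nat.strong_induction_on with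
    | _ m ih =>
      intro hm
      have hprev : ∀ j : ℤ, j < m → v j ∈ Set.Ioc (-1) 1 := by
        intro j hj
        rcases lt_or_ge j 0 with hj0 | hj0
        · rw [hv0 j hj0]
          norm_num
        · lift j to ℕ using hj0
          exact ih j (by omega) (by omega)
      obtain ⟨ha1, ha2⟩ := hprev (m - 1) (by omega)
      obtain ⟨hb1, hb2⟩ := hprev (m - k) (by omega)
      have hy : |y m| ≤ ⨆ n : Fin N, |y ((n : ℕ) : ℤ)| :=
        le_ciSup (f := fun n : Fin N => |y ((n : ℕ) : ℤ)|) (Set.finite_range _).bddAbove ⟨m, hm⟩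
      obtain ⟨hy1, hy2⟩ := abs_le.1 (hy.trans (le_sub_comm.1 hstab))
      rw [hv m (by omega) (by omega), hq m (by omega) (by omega), filter_conv_eq hk hh]
      generalize (k : ℝ) / ((k : ℝ) - 1) = α at *
      have hlow : -2 < α * v (m - 1) + (1 - α) * v (m - k) + y m := by nlinarith
      have hupp : α * v (m - 1) + (1 - α) * v (m - k) + y m ≤ 2 := by nlinarith
      generalize α * v (m - 1) + (1 - α) * v (m - k) + y m = x at *
      unfold sgn
      split_ifs <;> constructor <;> linarith
  rcases lt_or_ge n 0 with hn0 | hn0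
  · rw [hv0 n hn0]
    norm_num
  · lift n to ℕ using hn0
    exact hnat n (by omega)

/-- If the quantizer state is in `(-1, 1]`, then the first difference of `g ∗ v` is in `(-2, 2)`. -/
theorem abs_bdiff_state_lt_two {k : ℕ} (hk : 2 ≤ k) {h g : ℤ → ℝ}
    (hh : ∀ j : ℤ, h j =
      if j = 1 then (k : ℝ) / ((k : ℝ) - 1)
      else if j = (k : ℤ) then 1 - (k : ℝ) / ((k : ℝ) - 1) else 0)
    (hgfin : (Function.support g).Finite)
    (hg : ∀ n : ℤ, bdiff (bdiff g) n = (if n = 0 then (1 : ℝ) else 0) - h n)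
    {v u : ℤ → ℝ} (hu : ∀ n : ℤ, u n = ∑ᶠ j : ℤ, g j * v (n - j))
    (n : ℤ) (hv : ∀ m ≤ n, v m ∈ Set.Ioc (-1) 1) : |bdiff u n| < 2 := by
  have hk' : (2 : ℝ) ≤ k := by exact_mod_cast hk
  have hsub : (Function.support fun j => bdiff g j * v (n - j)) ⊆
      ↑(insert 0 (Finset.Icc (1 : ℤ) (k - 1))) := by
    intro j hj
    by_contra hjm
    rw [Finset.mem_coe, Finset.mem_insert, Finset.mem_Icc] at hjm
    apply hj
    rcases lt_or_ge j 0 with hj0 | hj0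
    · simp only
      rw [bdiff_filter_neg hh hgfin hg j hj0, zero_mul]
    · lift j to ℕ using hj0
      simp only
      rw [bdiff_filter_nat hk hh hgfin hg, if_neg (by omega), if_neg (by omega), zero_mul]
  have hzero : bdiff g 0 = 1 := by simpa using bdiff_filter_nat hk hh hgfin hg 0
  have hrest : ∑ j ∈ Finset.Icc (1 : ℤ) (k - 1), bdiff g j * v (n - j) =
      (1 - (k : ℝ) / ((k : ℝ) - 1)) * ∑ j ∈ Finset.Icc (1 : ℤ) (k - 1), v (n - j) := by
    rw [Finset.mul_sum]
    refine Finset.sum_congr rfl fun j hj => ?_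
    rw [Finset.mem_Icc] at hj
    lift j to ℕ using (by omega)
    rw [bdiff_filter_nat hk hh hgfin hg, if_neg (by omega), if_pos (by omega)]
  rw [bdiff_conv hgfin hu, finsum_eq_sum_of_support_subset _ hsub, Finset.sum_insert (by simp),
    hrest, hzero, one_mul, sub_zero]
  have hcard : ((Finset.Icc (1 : ℤ) (k - 1)).card : ℝ) = k - 1 := by
    rw [Int.card_Icc, sub_add_cancel, ← Int.cast_natCast, Int.toNat_of_nonneg (by omega)]
    push_cast
    ring
  have hmem : ∀ j ∈ Finset.Icc (1 : ℤ) (k - 1), v (n - j) ∈ Set.Ioc (-1) 1 := by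
    intro j hj
    rw [Finset.mem_Icc] at hj
    exact hv _ (by omega)
  have hlow : -((k : ℝ) - 1) < ∑ j ∈ Finset.Icc (1 : ℤ) (k - 1), v (n - j) := by
    have := Finset.sum_lt_sum_of_nonempty (f := fun _ => (-1 : ℝ))
      (Finset.nonempty_Icc.2 (by omega)) fun j hj => (hmem j hj).1
    rwa [Finset.sum_const, nsmul_eq_mul, hcard, mul_neg_one] at this
  have hupp : ∑ j ∈ Finset.Icc (1 : ℤ) (k - 1), v (n - j) ≤ (k : ℝ) - 1 := by
    have := Finset.sum_le_sum (g := fun _ => (1 : ℝ)) fun j hj => (hmem j hj).2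
    rwa [Finset.sum_const, nsmul_eq_mul, hcard, mul_one] at this
  generalize ∑ j ∈ Finset.Icc (1 : ℤ) (k - 1), v (n - j) = S at *
  have hcoef : (1 - (k : ℝ) / ((k : ℝ) - 1)) * S = -(S / ((k : ℝ) - 1)) := by
    have : (k : ℝ) - 1 ≠ 0 := by linarith
    field_simp
    ring
  have hS1 : -1 < S / ((k : ℝ) - 1) := by
    rw [lt_div_iff₀ (by linarith)]
    linarith
  have hS2 : S / ((k : ℝ) - 1) ≤ 1 := by
    rw [div_le_iff₀ (by linarith)]
    linarith
  obtain ⟨hn1, hn2⟩ := hv n le_rfl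
  rw [hcoef, abs_lt]
  constructor <;> linarith

/-- Two sign sequences have sums differing by an even integer. -/
theorem exists_sum_sub_eq_two_mul {a b : ℕ → ℝ} (m : ℕ)
    (ha : ∀ i < m, a i = 1 ∨ a i = -1) (hb : ∀ i < m, b i = 1 ∨ b i = -1) :
    ∃ z : ℤ, ∑ i ∈ Finset.range m, (a i - b i) = 2 * z := by
  induction m with
  | zero => exact ⟨0, by simp⟩
  | succ m ih =>
    obtain ⟨z, hz⟩ := ih (fun i hi => ha i (by omega)) fun i hi => hb i (by omega)
    rw [Finset.sum_range_succ, hz]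
    rcases ha m (by omega) with h1 | h1 <;> rcases hb m (by omega) with h2 | h2 <;> rw [h1, h2]
    · exact ⟨z, by ring⟩
    · exact ⟨z + 1, by push_cast; ring⟩
    · exact ⟨z - 1, by push_cast; ring⟩
    · exact ⟨z, by ring⟩

/-- **Uniform update for the second-order ΣΔ quantizer.**
Let `h` be the second-order feedback filter with `k` tabs
(`h₀ = 0`, `h₁ = k/(k-1)`, `h_k = 1 - k/(k-1)`, all other entries zero),
and let `g` be the finitely supported sequence with `Δ²g = δ⁰ - h`.
Run the ΣΔ quantizer with filter `h` on samples `y₀,…,y_{N-1}`, obtaining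
state variables `v`, bits `q`, and second-order state `u = g ∗ v`.
Set `δ = -(Δu)_{N-1}/N`, and assume the updated samples `ỹₙ = yₙ + δ` satisfy
the stability criterion `‖h‖₁ ≤ 2 - maxₙ |ỹₙ|`.  Re-running the quantizer on
the updated samples gives `ṽ, q̃` and `ũ = g ∗ ṽ` with `(Δũ)_{N-1} = 0`. -/
theorem second_order_update (k : ℕ) (hk : 2 ≤ k) (h g : ℤ → ℝ)
    (hh : ∀ j : ℤ, h j =
      if j = 1 then (k : ℝ) / ((k : ℝ) - 1)
      else if j = (k : ℤ) then 1 - (k : ℝ) / ((k : ℝ) - 1) else 0)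
    (hgfin : (Function.support g).Finite)
    (hg : ∀ n : ℤ, bdiff (bdiff g) n = (if n = 0 then (1 : ℝ) else 0) - h n)
    (N : ℕ) (hN : 1 ≤ N) (y v q u vv qq uu : ℤ → ℝ)
    (hv0 : ∀ n : ℤ, n < 0 → v n = 0)
    (hq : ∀ n : ℤ, 0 ≤ n → n < (N : ℤ) →
      q n = sgn ((∑ j ∈ Finset.Icc (1 : ℤ) (k : ℤ), h j * v (n - j)) + y n))
    (hv : ∀ n : ℤ, 0 ≤ n → n < (N : ℤ) →
      v n = (∑ j ∈ Finset.Icc (1 : ℤ) (k : ℤ), h j * v (n - j)) + y n - q n)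
    (hu : ∀ n : ℤ, u n = ∑ᶠ j : ℤ, g j * v (n - j))
    (δ : ℝ) (hδ : δ = -(bdiff u ((N : ℤ) - 1)) / N)
    (hstab : ∑ j ∈ Finset.Icc (0 : ℤ) (k : ℤ), |h j| ≤
      2 - ⨆ n : Fin N, |y ((n : ℕ) : ℤ) + δ|)
    (hvv0 : ∀ n : ℤ, n < 0 → vv n = 0)
    (hqq : ∀ n : ℤ, 0 ≤ n → n < (N : ℤ) →
      qq n = sgn ((∑ j ∈ Finset.Icc (1 : ℤ) (k : ℤ), h j * vv (n - j)) + (y n + δ)))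
    (hvv : ∀ n : ℤ, 0 ≤ n → n < (N : ℤ) →
      vv n = (∑ j ∈ Finset.Icc (1 : ℤ) (k : ℤ), h j * vv (n - j)) + (y n + δ) - qq n)
    (huu : ∀ n : ℤ, uu n = ∑ᶠ j : ℤ, g j * vv (n - j)) :
    bdiff uu ((N : ℤ) - 1) = 0 := by
  have hU := bdiff_state_eq_sum hk hh hgfin hg hv0 hv hu N le_rfl
  have hUU := bdiff_state_eq_sum (y := fun n => y n + δ) hk hh hgfin hg hvv0 hvv huu N le_rfl
  have hbound : |bdiff uu ((N : ℤ) - 1)| < 2 :=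
    abs_bdiff_state_lt_two hk hh hgfin hg huu _ fun m hm =>
      state_mem_Ioc (y := fun n => y n + δ) hk hh hstab hvv0 hqq hvv m (by omega)
  obtain ⟨z, hz⟩ := exists_sum_sub_eq_two_mul (a := fun i => q i) (b := fun i => qq i) N
    (fun i hi => by
      rw [hq i (by omega) (by omega)]
      exact sgn_eq_or _)
    (fun i hi => by
      rw [hqq i (by omega) (by omega)]
      exact sgn_eq_or _)
  have hNδ : N * δ = -bdiff u ((N : ℤ) - 1) := by
    have : (N : ℝ) ≠ 0 := by positivity
    rw [hδ]
    field_simp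
  have heven : bdiff uu ((N : ℤ) - 1) = 2 * z := by
    simp only [Finset.sum_sub_distrib, Finset.sum_add_distrib, Finset.sum_const,
      Finset.card_range, nsmul_eq_mul] at hU hUU hz
    linarith
  rw [heven, abs_lt] at hbound
  have hz1 : (-1 : ℝ) < z := by linarith
  have hz2 : (z : ℝ) < 1 := by linarith
  have hz1' : -1 < z := by exact_mod_cast hz1
  have hz2' : z < 1 := by exact_mod_cast hz2
  have hz0 : z = 0 := by omega
  rw [heven, hz0, Int.cast_zero, mul_zero]
end
end

section
/- Let f be K-bandlimited on the circle, N ≥ 2K+1, and y_n := f(2πn/N) for 0 ≤ n ≤ N−1. Let q_0,…,q_{N−1} ∈ ℝ and let u : ℤ → ℝ satisfy u_{−1} = 0 and u_n − u_{n−1} = y_n − q_n for 0 ≤ n ≤ N−1. Let f_r be the reconstruction from (q_n). Then for all t ∈ ℝ, |f(t) − f_r(t)| ≤ (max_{0≤n≤N−1}|u_n| / N)·‖(φ^K)'‖_{L¹[0,2π]} + (|u_{N−1}|/N)·‖φ^K‖_∞. -/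
noncomputable section
open Real
open scoped Classical

/-- The Dirichlet kernel `φᴷ`. -/
def dirichlet (K : ℕ) (x : ℝ) : ℝ :=
  if ∃ m : ℤ, x = 2 * π * m then 2 * K + 1
  else Real.sin ((2 * K + 1) * x / 2) / Real.sin (x / 2)

/-- `f : ℝ → ℝ` is `K`-bandlimited on the circle. -/
def KBandlimited (K : ℕ) (f : ℝ → ℝ) : Prop :=
  ∃ c : ℤ → ℂ, ∀ t : ℝ, (f t : ℂ) =
    ∑ ξ ∈ Finset.Icc (-(K : ℤ)) (K : ℤ), c ξ * Complex.exp (Complex.I * ξ * t)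

open Finset in
/-- Closed form of the Dirichlet kernel, cleared of its denominator. -/
lemma sin_half_mul_one_add_two_sum_cos (K : ℕ) (x : ℝ) :
    Real.sin (x / 2) * (1 + 2 * ∑ k ∈ range K, Real.cos ((k + 1) * x)) =
      Real.sin ((2 * K + 1) * x / 2) := by
  induction K with
  | zero => simp
  | succ K ih =>
    rw [sum_range_succ, mul_add 2, ← add_assoc, mul_add, ih]
    have h1 : (2 * (K : ℝ) + 1) * x / 2 = (K + 1) * x - x / 2 := by ring
    have h2 : (2 * ((K + 1 : ℕ) : ℝ) + 1) * x / 2 = (K + 1) * x + x / 2 := by push_cast; ring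
    rw [h1, h2, Real.sin_sub, Real.sin_add]
    ring

lemma dirichlet_eq_sum_cos (K : ℕ) (x : ℝ) :
    dirichlet K x = 1 + 2 * ∑ k ∈ Finset.range K, Real.cos ((k + 1) * x) := by
  unfold dirichlet
  split_ifs with h
  · obtain ⟨m, rfl⟩ := h
    have hcos (k : ℕ) : Real.cos ((k + 1) * (2 * π * m)) = 1 := by
      rw [Real.cos_eq_one_iff]
      exact ⟨(k + 1) * m, by push_cast; ring⟩
    simp only [hcos]
    simp
    ring
  · have hsin : Real.sin (x / 2) ≠ 0 := by
      rw [Ne, Real.sin_eq_zero_iff]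
      rintro ⟨m, hm⟩
      exact h ⟨m, by linarith⟩
    rw [div_eq_iff hsin, ← sin_half_mul_one_add_two_sum_cos]
    ring

lemma dirichlet_eq_sum_exp (K : ℕ) (x : ℝ) :
    (dirichlet K x : ℂ) =
      ∑ ξ ∈ Finset.Icc (-(K : ℤ)) (K : ℤ), Complex.exp (Complex.I * ξ * x) := by
  rw [dirichlet_eq_sum_cos]
  induction K with
  | zero => simp
  | succ K ih =>
    have hIcc : Finset.Icc (-((K + 1 : ℕ) : ℤ)) ((K + 1 : ℕ) : ℤ) =
        insert (-(K + 1 : ℤ)) (insert (K + 1 : ℤ) (Finset.Icc (-(K : ℤ)) (K : ℤ))) := by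
      ext a
      simp only [Finset.mem_insert, Finset.mem_Icc]
      omega
    rw [hIcc, Finset.sum_insert, Finset.sum_insert, ← ih, Finset.sum_range_succ]
    · push_cast
      have h1 : Complex.I * (-(K + 1)) * x = -((K + 1) * x) * Complex.I := by ring
      have h2 : Complex.I * (K + 1) * x = (K + 1) * x * Complex.I := by ring
      rw [mul_add 2, Complex.two_cos, h1, h2]
      ring
    · simp
    · simp only [Finset.mem_insert, Finset.mem_Icc]
      omega

lemma contDiff_dirichlet (K : ℕ) : ContDiff ℝ 1 (dirichlet K) := by
  rw [funext (dirichlet_eq_sum_cos K)]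
  fun_prop

lemma dirichlet_periodic (K : ℕ) : Function.Periodic (dirichlet K) (2 * π) := by
  intro x
  simp only [dirichlet_eq_sum_cos]
  congr 2
  refine Finset.sum_congr rfl fun k _ => ?_
  rw [mul_add]
  exact_mod_cast Real.cos_add_nat_mul_two_pi _ (k + 1)

lemma bddAbove_range_abs_dirichlet (K : ℕ) : BddAbove (Set.range fun x => |dirichlet K x|) := by
  refine ⟨1 + 2 * ∑ _k ∈ Finset.range K, (1 : ℝ), ?_⟩
  rintro _ ⟨x, rfl⟩
  simp only [dirichlet_eq_sum_cos]
  refine (abs_add_le _ _).trans ?_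
  rw [abs_one, abs_mul, abs_two]
  gcongr
  exact (Finset.abs_sum_le_sum_abs _ _).trans
    (Finset.sum_le_sum fun k _ => Real.abs_cos_le_one _)

/-- Orthogonality of the characters of `ℤ/N`, sampled on the circle. -/
lemma sum_exp_samples (N : ℕ) (d : ℤ) (hd : |d| < N) :
    ∑ n ∈ Finset.range N, Complex.exp (Complex.I * d * (2 * π * n / N : ℝ)) =
      if d = 0 then (N : ℂ) else 0 := by
  split_ifs with h
  · simp [h]
  have hN : (N : ℂ) ≠ 0 := by
    rintro h0
    have : N = 0 := by exact_mod_cast h0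
    have := abs_nonneg d
    omega
  set w : ℂ := Complex.exp (2 * π * Complex.I * (d / N)) with hw
  have hpow (n : ℕ) : Complex.exp (Complex.I * d * (2 * π * n / N : ℝ)) = w ^ n := by
    rw [hw, ← Complex.exp_nat_mul]
    congr 1
    push_cast
    ring
  have hw1 : w ≠ 1 := by
    rw [hw, Ne, Complex.exp_eq_one_iff]
    rintro ⟨m, hm⟩
    have h2 : (d : ℂ) / N = m :=
      mul_left_cancel₀ Complex.two_pi_I_ne_zero (by rw [hm]; ring)
    rw [div_eq_iff hN] at h2
    have h3 : d = m * N := by exact_mod_cast h2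
    exact h (Int.eq_zero_of_abs_lt_dvd ⟨m, by rw [h3]; ring⟩ hd)
  have hwN : w ^ N = 1 := by
    rw [hw, ← Complex.exp_nat_mul, Complex.exp_eq_one_iff]
    exact ⟨d, by field_simp⟩
  simp only [hpow]
  rw [geom_sum_eq hw1, hwN]
  simp

/-- Sampling theorem on the circle. -/
lemma KBandlimited.sum_samples {K N : ℕ} (hN : 2 * K + 1 ≤ N) {f : ℝ → ℝ}
    (hf : KBandlimited K f) (t : ℝ) :
    ∑ n ∈ Finset.range N, f (2 * π * n / N) * dirichlet K (t - 2 * π * n / N) = N * f t := by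
  obtain ⟨c, hc⟩ := hf
  apply Complex.ofReal_injective
  rw [Complex.ofReal_sum]
  simp only [Complex.ofReal_mul, hc, dirichlet_eq_sum_exp, Finset.sum_mul_sum]
  rw [Finset.sum_comm, Finset.mul_sum]
  refine Finset.sum_congr rfl fun ξ hξ => ?_
  rw [Finset.sum_comm]
  have hterm (η : ℤ) (n : ℕ) :
      c ξ * Complex.exp (Complex.I * ξ * (2 * π * n / N : ℝ)) *
          Complex.exp (Complex.I * η * (t - 2 * π * n / N : ℝ)) =
        c ξ * Complex.exp (Complex.I * η * t) *
          Complex.exp (Complex.I * (ξ - η : ℤ) * (2 * π * n / N : ℝ)) := by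
    rw [mul_assoc (c ξ), mul_assoc (c ξ), ← Complex.exp_add, ← Complex.exp_add]
    congr 2
    push_cast
    ring
  simp only [hterm, ← Finset.mul_sum]
  rw [Finset.sum_congr rfl fun η hη => by
    rw [sum_exp_samples N (ξ - η) (by
      rw [Finset.mem_Icc] at hξ hη
      rw [abs_lt]
      omega)]]
  simp only [sub_eq_zero, mul_ite, mul_zero, Finset.sum_ite_eq, if_pos hξ]
  rw [Complex.ofReal_natCast]
  ring

lemma sum_diff_mul_eq (u : ℤ → ℝ) (hu0 : u (-1) = 0) (a : ℕ → ℝ) (M : ℕ) :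
    ∑ n ∈ Finset.range M, (u n - u (n - 1)) * a n =
      ∑ n ∈ Finset.range M, u n * (a n - a (n + 1)) + u (M - 1) * a M := by
  induction M with
  | zero => simp [hu0]
  | succ M ih =>
    rw [Finset.sum_range_succ, ih, Finset.sum_range_succ]
    push_cast
    rw [add_sub_cancel_right]
    ring

/-- The variation of a periodic `C¹` function along `N` equispaced points of a period. -/
lemma sum_abs_sub_le_integral_abs_deriv {φ : ℝ → ℝ} {T : ℝ} (hφ : ContDiff ℝ 1 φ) (hT : 0 ≤ T)
    (hper : Function.Periodic φ T) {N : ℕ} (hN : N ≠ 0) (t : ℝ) :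
    ∑ n ∈ Finset.range N, |φ (t - T * n / N) - φ (t - T * (n + 1 : ℕ) / N)| ≤
      ∫ x in (0 : ℝ)..T, |deriv φ x| := by
  have hcont : Continuous (deriv φ) := hφ.continuous_deriv le_rfl
  have hint (a b : ℝ) : IntervalIntegrable (fun x => |deriv φ x|) MeasureTheory.volume a b :=
    hcont.abs.intervalIntegrable a b
  have hderiv : Function.Periodic (fun x => |deriv φ x|) T := fun x => by
    simp only
    rw [← deriv_comp_add_const, funext hper]
  set a : ℕ → ℝ := fun n => t - T * n / N with ha
  have hstep (n : ℕ) : |φ (a n) - φ (a (n + 1))| ≤ -∫ x in a n..a (n + 1), |deriv φ x| := by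
    rw [← intervalIntegral.integral_deriv_eq_sub
      (fun x _ => (hφ.differentiable one_ne_zero).differentiableAt)
      (hcont.intervalIntegrable _ _), ← intervalIntegral.integral_symm]
    apply intervalIntegral.abs_integral_le_integral_abs
    simp only [ha]
    gcongr
    omega
  calc ∑ n ∈ Finset.range N, |φ (a n) - φ (a (n + 1))|
      ≤ ∑ n ∈ Finset.range N, -∫ x in a n..a (n + 1), |deriv φ x| :=
        Finset.sum_le_sum fun n _ => hstep n
    _ = ∫ x in (t - T)..(t - T + T), |deriv φ x| := by
        rw [Finset.sum_neg_distrib, intervalIntegral.sum_integral_adjacent_intervals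
          fun k _ => hint _ _, ← intervalIntegral.integral_symm]
        have hN' : (N : ℝ) ≠ 0 := by exact_mod_cast hN
        simp [ha, hN']
    _ = ∫ x in (0 : ℝ)..T, |deriv φ x| := by
        rw [hderiv.intervalIntegral_add_eq (t - T) 0, zero_add]

/-- **Error analysis for the first-order ΣΔ scheme on the circle.**
If `f` is `K`-bandlimited, `N ≥ 2K+1`, `yₙ = f(2πn/N)`, and
`u` satisfies `u₋₁ = 0` and `uₙ - u_{n-1} = yₙ - qₙ` for `0 ≤ n ≤ N-1`, then the
reconstruction `fᵣ` from `(qₙ)` satisfies, for all `t`,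
`|f(t) - fᵣ(t)| ≤ (maxₙ|uₙ|/N)·‖(φᴷ)'‖_{L¹[0,2π]} + (|u_{N-1}|/N)·‖φᴷ‖_∞`. -/
theorem first_order_error (K N : ℕ) (hN : 2 * K + 1 ≤ N)
    (f : ℝ → ℝ) (hf : KBandlimited K f)
    (q u : ℤ → ℝ)
    (hu0 : u (-1) = 0)
    (hrec : ∀ n : ℤ, 0 ≤ n → n < (N : ℤ) →
      u n - u (n - 1) = f (2 * π * n / N) - q n) :
    ∀ t : ℝ,
      |f t - (1 / N) * ∑ n ∈ Finset.range N, q n * dirichlet K (t - 2 * π * n / N)| ≤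
        ((⨆ n : Fin N, |u ((n : ℕ) : ℤ)|) / N) *
            (∫ x in (0 : ℝ)..(2 * π), |deriv (dirichlet K) x|) +
          (|u ((N : ℤ) - 1)| / N) * ⨆ x : ℝ, |dirichlet K x| := by
  intro t
  have hN0 : N ≠ 0 := by omega
  have hNpos : (0 : ℝ) < N := by exact_mod_cast Nat.pos_of_ne_zero hN0
  set φ : ℕ → ℝ := fun n => dirichlet K (t - 2 * π * n / N)
  set U : ℝ := ⨆ n : Fin N, |u ((n : ℕ) : ℤ)|
  have herr : f t - (1 / N) * ∑ n ∈ Finset.range N, q n * φ n =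
      (∑ n ∈ Finset.range N, u n * (φ n - φ (n + 1)) + u (N - 1) * φ N) / N := by
    rw [← sum_diff_mul_eq u hu0 φ N]
    have hsum : ∑ n ∈ Finset.range N, (u n - u (n - 1)) * φ n =
        N * f t - ∑ n ∈ Finset.range N, q n * φ n := by
      rw [← hf.sum_samples hN t, ← Finset.sum_sub_distrib]
      refine Finset.sum_congr rfl fun n hn => ?_
      rw [hrec n (by omega) (by exact_mod_cast Finset.mem_range.mp hn), Int.cast_natCast]
      ring
    rw [hsum]
    field_simp
  have hmain : |∑ n ∈ Finset.range N, u n * (φ n - φ (n + 1))| ≤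
      U * ∫ x in (0 : ℝ)..(2 * π), |deriv (dirichlet K) x| := by
    refine (Finset.abs_sum_le_sum_abs _ _).trans ?_
    have hle : ∑ n ∈ Finset.range N, |u n * (φ n - φ (n + 1))| ≤
        ∑ n ∈ Finset.range N, U * |φ n - φ (n + 1)| := by
      refine Finset.sum_le_sum fun n hn => ?_
      rw [abs_mul]
      gcongr
      exact le_ciSup (f := fun n : Fin N => |u ((n : ℕ) : ℤ)|) (Set.finite_range _).bddAbove
        ⟨n, Finset.mem_range.mp hn⟩
    refine hle.trans ?_
    rw [← Finset.mul_sum]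
    refine mul_le_mul_of_nonneg_left ?_ (Real.iSup_nonneg fun _ => abs_nonneg _)
    exact sum_abs_sub_le_integral_abs_deriv (contDiff_dirichlet K) Real.two_pi_pos.le
      (dirichlet_periodic K) hN0 t
  have hlast : |u (N - 1) * φ N| ≤ |u (N - 1)| * ⨆ x : ℝ, |dirichlet K x| := by
    rw [abs_mul]
    gcongr
    exact le_ciSup (bddAbove_range_abs_dirichlet K) _
  rw [herr, abs_div, abs_of_pos hNpos, div_mul_eq_mul_div, div_mul_eq_mul_div, ← add_div]
  gcongr
  exact (abs_add_le _ _).trans (add_le_add hmain hlast)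
end
end
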